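/- Let H be a real Hilbert space, f : H → ℝ ∪ {+∞} a proper, convex, lower semicontinuous function, and g : H → ℝ a convex Fréchet differentiable function whose gradient ∇g is L_g-Lipschitz continuous (L_g > 0). Then for every s > 0 and all x, y ∈ H, writing P = prox_{sf}(y − s∇g(y)): (f+g)(P) ≤ (f+g)(x) − (1/s)⟨y − P, x − y⟩ + (L_g/2 − 1/s)‖P − y‖² − (1/(2L_g))‖∇g(y) − ∇g(x)‖². -/

import Mathlib

open Filter Topology
open scoped RealInnerProductSpace

section Gradient

variable {H : Type*} [NormedAddCommGroup H] [InnerProductSpace ℝ H] [CompleteSpace H]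

theorem HasGradientAt.hasDerivAt_comp_add_smul {g : H → ℝ} {v : H} {y d : H} {t : ℝ}
    (hg : HasGradientAt g v (y + t • d)) :
    HasDerivAt (fun r : ℝ => g (y + r • d)) ⟪v, d⟫ t := by
  have hline : HasDerivAt (fun r : ℝ => y + r • d) d t := by
    simpa using ((hasDerivAt_id t).smul_const d).const_add y
  have h := hg.hasFDerivAt.comp_hasDerivAt t hline
  simpa [Function.comp_def, InnerProductSpace.toDual_apply_apply] using h

/-- The first-order characterization of convexity. -/
theorem ConvexOn.add_inner_gradient_le {g : H → ℝ} {v y : H}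
    (hconv : ConvexOn ℝ Set.univ g) (hg : HasGradientAt g v y) (z : H) :
    g y + ⟪v, z - y⟫ ≤ g z := by
  have hline : ConvexOn ℝ Set.univ (fun r : ℝ => g (y + r • (z - y))) := by
    have h := hconv.comp_affineMap (AffineMap.lineMap (k := ℝ) y z)
    simpa [Function.comp_def, AffineMap.lineMap_apply, add_comm] using h
  have hderiv : HasDerivAt (fun r : ℝ => g (y + r • (z - y))) ⟪v, z - y⟫ 0 :=
    HasGradientAt.hasDerivAt_comp_add_smul (by simpa using hg)
  have h := hline.le_slope_of_hasDerivAt (Set.mem_univ 0) (Set.mem_univ 1) zero_lt_one hderiv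
  simp [slope_def_field] at h
  linarith

/-- The descent lemma for functions with Lipschitz gradient. -/
theorem le_add_inner_add_norm_sq_of_gradient_lipschitz {g : H → ℝ} {g' : H → H} {L : ℝ}
    (hg : ∀ u, HasGradientAt g (g' u) u) (hlip : ∀ u v, ‖g' u - g' v‖ ≤ L * ‖u - v‖)
    (y z : H) : g z ≤ g y + ⟪g' y, z - y⟫ + L / 2 * ‖z - y‖ ^ 2 := by
  set d := z - y with hd
  let φ : ℝ → ℝ := fun r => g (y + r • d) - (r * ⟪g' y, d⟫ + r ^ 2 * (L / 2 * ‖d‖ ^ 2))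
  have hφ (t : ℝ) : HasDerivAt φ
      (⟪g' (y + t • d), d⟫ - (⟪g' y, d⟫ + 2 * t * (L / 2 * ‖d‖ ^ 2))) t := by
    refine (hg _).hasDerivAt_comp_add_smul.sub (HasDerivAt.add ?_ ?_)
    · simpa using (hasDerivAt_id t).mul_const ⟪g' y, d⟫
    · simpa using (hasDerivAt_pow 2 t).mul_const (L / 2 * ‖d‖ ^ 2)
  have hanti : AntitoneOn φ (Set.Ici 0) := by
    refine antitoneOn_of_deriv_nonpos (convex_Ici 0)
      (fun t _ => (hφ t).continuousAt.continuousWithinAt)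
      (fun t _ => (hφ t).differentiableAt.differentiableWithinAt) fun t ht => ?_
    rw [interior_Ici, Set.mem_Ioi] at ht
    rw [(hφ t).deriv]
    have hinner := real_inner_le_norm (g' (y + t • d) - g' y) d
    have hnorm := mul_le_mul_of_nonneg_right (hlip (y + t • d) y) (norm_nonneg d)
    rw [add_sub_cancel_left, norm_smul, Real.norm_of_nonneg ht.le] at hnorm
    rw [inner_sub_left] at hinner
    nlinarith
  have h := hanti (Set.mem_Ici.2 le_rfl) (Set.mem_Ici.2 zero_le_one) zero_le_one
  simp only [φ, zero_smul, one_smul, add_zero, hd, add_sub_cancel] at h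
  simp only [hd]
  linarith

/-- The strengthening of the gradient inequality for convex functions with Lipschitz gradient. -/
theorem ConvexOn.add_inner_add_norm_sq_le_of_gradient_lipschitz {g : H → ℝ} {g' : H → H} {L : ℝ}
    (hL : 0 < L) (hconv : ConvexOn ℝ Set.univ g) (hg : ∀ u, HasGradientAt g (g' u) u)
    (hlip : ∀ u v, ‖g' u - g' v‖ ≤ L * ‖u - v‖) (x y : H) :
    g y + ⟪g' y, x - y⟫ + 1 / (2 * L) * ‖g' y - g' x‖ ^ 2 ≤ g x := by
  set w := g' y - g' x with hw
  have hlow := hconv.add_inner_gradient_le (hg y) (x + L⁻¹ • w)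
  have hup := le_add_inner_add_norm_sq_of_gradient_lipschitz hg hlip x (x + L⁻¹ • w)
  rw [add_sub_cancel_left, norm_smul, Real.norm_of_nonneg (inv_nonneg.2 hL.le),
    real_inner_smul_right] at hup
  rw [add_sub_right_comm, inner_add_right, real_inner_smul_right] at hlow
  have hinner : L⁻¹ * ⟪g' y, w⟫ - L⁻¹ * ⟪g' x, w⟫ = L⁻¹ * ‖w‖ ^ 2 := by
    rw [← mul_sub, ← inner_sub_left, ← hw, real_inner_self_eq_norm_sq]
  have hscale : L / 2 * (L⁻¹ * ‖w‖) ^ 2 = L⁻¹ * ‖w‖ ^ 2 - 1 / (2 * L) * ‖w‖ ^ 2 := by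
    field_simp
    ring
  linarith

end Gradient

/-- The variational inequality satisfied by the proximal point `P` of `z`. -/
theorem le_add_inner_of_isProx {H : Type*} [NormedAddCommGroup H] [InnerProductSpace ℝ H]
    {f : H → EReal} {s : ℝ} (hs : 0 < s) {P x z : H} {p q : ℝ} (hfP : f P = p) (hfx : f x = q)
    (hconv : ∀ u v : H, ∀ a b : ℝ, 0 ≤ a → 0 ≤ b → a + b = 1 →
      f (a • u + b • v) ≤ (a : EReal) * f u + (b : EReal) * f v)
    (hP : ∀ u : H, f P + ((‖P - z‖ ^ 2 / (2 * s) : ℝ) : EReal)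
        ≤ f u + ((‖u - z‖ ^ 2 / (2 * s) : ℝ) : EReal)) :
    p ≤ q + 1 / s * ⟪P - z, x - P⟫ := by
  have hbound : ∀ t ∈ Set.Ioc (0 : ℝ) 1,
      p ≤ q + 1 / s * ⟪P - z, x - P⟫ + t * (‖x - P‖ ^ 2 / (2 * s)) := by
    rintro t ⟨ht0, ht1⟩
    have hmin := (hP ((1 - t) • P + t • x)).trans (add_le_add_left
      (hconv P x (1 - t) t (sub_nonneg.2 ht1) ht0.le (sub_add_cancel 1 t)) _)
    rw [hfP, hfx] at hmin
    norm_cast at hmin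
    have hpoint : (1 - t) • P + t • x - z = (P - z) + t • (x - P) := by module
    rw [hpoint, norm_add_sq_real, real_inner_smul_right, norm_smul,
      Real.norm_of_nonneg ht0.le] at hmin
    refine le_of_mul_le_mul_left ?_ ht0
    have hexpand : (‖P - z‖ ^ 2 + 2 * (t * ⟪P - z, x - P⟫) + (t * ‖x - P‖) ^ 2) / (2 * s)
        = ‖P - z‖ ^ 2 / (2 * s)
          + t * (1 / s * ⟪P - z, x - P⟫ + t * (‖x - P‖ ^ 2 / (2 * s))) := by
      field_simp
      ring
    rw [hexpand] at hmin
    linarith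
  have hlim : Tendsto
      (fun t : ℝ => q + 1 / s * ⟪P - z, x - P⟫ + t * (‖x - P‖ ^ 2 / (2 * s)))
      (𝓝[>] 0) (𝓝 (q + 1 / s * ⟪P - z, x - P⟫)) := by
    refine tendsto_nhdsWithin_of_tendsto_nhds ?_
    have hcont : Continuous
        fun t : ℝ => q + 1 / s * ⟪P - z, x - P⟫ + t * (‖x - P‖ ^ 2 / (2 * s)) := by fun_prop
    simpa using hcont.tendsto 0
  exact ge_of_tendsto hlim (by filter_upwards [Ioc_mem_nhdsGT zero_lt_one] using hbound)

/-- Extended descent lemma (Lemma A.4, eq. (f5)): for proper convex lsc `f`, convex `g` with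
`L_g`-Lipschitz gradient, `s > 0` and `P = prox_{sf}(y − s∇g(y))`:
`(f+g)(P) ≤ (f+g)(x) − (1/s)⟨y − P, x − y⟩ + (L_g/2 − 1/s)‖P − y‖² − (1/(2L_g))‖∇g(y) − ∇g(x)‖²`. -/
theorem prox_descent_lemma
    {H : Type*} [NormedAddCommGroup H] [InnerProductSpace ℝ H] [CompleteSpace H]
    (f : H → EReal)
    (hf_proper : ∃ z, f z ≠ ⊤) (hf_nebot : ∀ z, f z ≠ ⊥)
    (hf_convex : ∀ u v : H, ∀ a b : ℝ, 0 ≤ a → 0 ≤ b → a + b = 1 →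
      f (a • u + b • v) ≤ (a : EReal) * f u + (b : EReal) * f v)
    (hf_lsc : LowerSemicontinuous f)
    (g : H → ℝ) (g' : H → H) (Lg : ℝ) (hLg : 0 < Lg)
    (hg_convex : ConvexOn ℝ Set.univ g)
    (hg_diff : ∀ u : H, HasGradientAt g (g' u) u)
    (hg_lip : ∀ u v : H, ‖g' u - g' v‖ ≤ Lg * ‖u - v‖)
    (s : ℝ) (hs : 0 < s) (x y : H)
    -- P = prox_{sf}(y − s∇g(y)) : the minimizer of u ↦ f(u) + ‖u − (y − s∇g(y))‖²/(2s)
    (P : H)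
    (hP : ∀ u : H, f P + ((‖P - (y - s • g' y)‖ ^ 2 / (2 * s) : ℝ) : EReal)
        ≤ f u + ((‖u - (y - s • g' y)‖ ^ 2 / (2 * s) : ℝ) : EReal)) :
    f P + (g P : EReal) ≤ f x + (g x : EReal)
      + ((-(1 / s) * ⟪y - P, x - y⟫ + (Lg / 2 - 1 / s) * ‖P - y‖ ^ 2
          - (1 / (2 * Lg)) * ‖g' y - g' x‖ ^ 2 : ℝ) : EReal) := by
  by_cases hfx : f x = ⊤
  · rw [hfx, EReal.top_add_coe, EReal.top_add_coe]
    exact le_top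
  have hfP : f P ≠ ⊤ := by
    obtain ⟨z, hz⟩ := hf_proper
    intro htop
    have h := hP z
    lift f z to ℝ using ⟨hz, hf_nebot z⟩ with r
    rw [htop, EReal.top_add_coe, ← EReal.coe_add, top_le_iff] at h
    exact EReal.coe_ne_top _ h
  have hp := (EReal.coe_toReal hfP (hf_nebot P)).symm
  have hq := (EReal.coe_toReal hfx (hf_nebot x)).symm
  have hprox := le_add_inner_of_isProx hs hp hq hf_convex hP
  have hdesc := le_add_inner_add_norm_sq_of_gradient_lipschitz hg_diff hg_lip y P
  have hgrad := hg_convex.add_inner_add_norm_sq_le_of_gradient_lipschitz hLg hg_diff hg_lip x y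
  have hinner : 1 / s * ⟪P - (y - s • g' y), x - P⟫ + ⟪g' y, P - y⟫ - ⟪g' y, x - y⟫
      = -(1 / s) * ⟪y - P, x - y⟫ - 1 / s * ‖P - y‖ ^ 2 := by
    have hleft : P - (y - s • g' y) = s • g' y - (y - P) := by abel
    have hright : x - P = (x - y) + (y - P) := by abel
    have hneg : P - y = -(y - P) := by abel
    rw [hleft, hright, hneg, norm_neg, inner_neg_right, inner_sub_left, inner_add_right,
      inner_add_right, real_inner_smul_left, real_inner_smul_left, real_inner_self_eq_norm_sq]
    field_simp
    ring
  rw [hp, hq]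
  norm_cast
  linarith
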